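/- For every α ∈ (0,1), if f ∈ 𝒱₁ satisfies ℛ_α(f) = f, then f has compact support. Consequently, lim_{x→+∞} f(x) = 0, the quantity b(f) := 2 c_{1,α} ∫₀^∞ f(ξ) ξ^{1−2α} dξ is finite, and c(f) < b(f); in particular the scaling parameter c_ℓ := c(f) − b(f) is strictly negative, so the fixed point corresponds to an expanding-type self-similar blow-up. -/

import Mathlib

open Real MeasureTheory Set Filter BoundedContinuousFunction

noncomputable section

namespace GSQGplane

/-- The constant `c_{1,α} = 2^{2α-1} Γ(1/2+α) / (√π Γ(1-α))`. -/
def C1 (α : ℝ) : ℝ :=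
  (2:ℝ) ^ (2*α - 1) * Real.Gamma (1/2 + α) / (Real.sqrt π * Real.Gamma (1 - α))

/-- The constant `η = 2 (3/(2(3-2α)(5-2α)(1+4^α)))^{1/min(α,1-α)}`. -/
def etaC (α : ℝ) : ℝ :=
  2 * (3 / (2*(3 - 2*α)*(5 - 2*α)*(1 + (4:ℝ) ^ α))) ^ (1 / min α (1 - α))

/-- The weight `ρ(x) = (1+|x|)^{-α}`. -/
def rho (α : ℝ) (x : ℝ) : ℝ := (1 + |x|) ^ (-α)

/-- The invariant set `𝒱₁`: even continuous functions with finite weighted sup-norm,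
`f(0)=1`, nonnegative and non-increasing on `[0,∞)`, `x ↦ f(√x)` convex,
`f ≥ max(0,1-x²)`, and left derivative at `1/2` at most `-η`. -/
def V1 (α : ℝ) (f : ℝ → ℝ) : Prop :=
  Continuous f ∧ (∀ x : ℝ, f (-x) = f x) ∧ (∃ M : ℝ, ∀ x : ℝ, rho α x * |f x| ≤ M) ∧
  f 0 = 1 ∧ (∀ x ∈ Ici (0:ℝ), 0 ≤ f x) ∧ AntitoneOn f (Ici (0:ℝ)) ∧
  ConvexOn ℝ (Ici (0:ℝ)) (fun x => f (Real.sqrt x)) ∧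
  (∀ x : ℝ, max 0 (1 - x^2) ≤ f x) ∧
  (∃ d : ℝ, HasDerivWithinAt f d (Iio (1/2 : ℝ)) (1/2 : ℝ) ∧ d ≤ -(etaC α))

/-- The normalization functional `c(f)`. -/
def cV (α : ℝ) (f : ℝ → ℝ) : ℝ :=
  (2*α*(1+2*α)/3) * C1 α * ∫ ξ in Ioi (0:ℝ), (1 - f ξ) * ξ ^ (-1 - 2*α)

/-- The functional `b(f) = 2 c_{1,α} ∫₀^∞ f(ξ) ξ^{1-2α} dξ`. -/
def bV (α : ℝ) (f : ℝ → ℝ) : ℝ :=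
  2 * C1 α * ∫ ξ in Ioi (0:ℝ), f ξ * ξ ^ (1 - 2*α)

/-- The linear operator `𝒯_α(f)`, defined for `x > 0`, set to `0` at `x = 0`,
and extended evenly to `ℝ` (via `|x|`). -/
def TV (α : ℝ) (f : ℝ → ℝ) (x : ℝ) : ℝ :=
  if x = 0 then 0
  else if α = 1/2 then
    C1 α * ∫ ξ in Ioi (0:ℝ), f ξ * ((ξ / |x|) * Real.log ((|x| + ξ) / |(|x| - ξ)|) - 2)
  else
    (C1 α / (1 - 2*α)) * ∫ ξ in Ioi (0:ℝ),
      f ξ * ((ξ / |x|) * ((|x| + ξ) ^ (1 - 2*α) - |(|x| - ξ)| ^ (1 - 2*α))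
        - 2*(1 - 2*α) * ξ ^ (1 - 2*α))

/-- The nonlinear map `ℛ_α(f)(x) = max(0, 1 + 𝒯_α(f)(x)/c(f))`. -/
def RV (α : ℝ) (f : ℝ → ℝ) (x : ℝ) : ℝ := max 0 (1 + TV α f x / cV α f)

/-- The positive part `u ∫_{|1-u|}^{1+u} v^{s-1} dv` of the rescaled kernel of `𝒯_α`,
where `s = 1 - 2α`. -/
def rieszKer (s u : ℝ) : ℝ := u * ∫ v in |1 - u|..(1 + u), v ^ (s - 1)

/-- The rescaled kernel of `𝒯_α`, where `s = 1 - 2α`. -/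
def diffKer (s u : ℝ) : ℝ := rieszKer s u - 2 * u ^ s

lemma abs_one_sub_lt_one_add {u : ℝ} (hu : 0 < u) : |1 - u| < 1 + u := by
  rw [abs_lt]; constructor <;> linarith

lemma rieszKer_of_ne {s u : ℝ} (hs : s ≠ 0) (hu : 0 < u) (hu1 : u ≠ 1) :
    rieszKer s u = u * (((1 + u) ^ s - |1 - u| ^ s) / s) := by
  have h0 : 0 < |1 - u| := abs_pos.2 (sub_ne_zero.2 hu1.symm)
  have h1 := abs_one_sub_lt_one_add hu
  rw [rieszKer, integral_rpow]
  · simp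
  · refine Or.inr ⟨fun h => hs (by linarith), fun h => ?_⟩
    rw [uIcc_of_le h1.le] at h
    exact absurd h.1 (not_le.2 h0)

lemma rieszKer_zero {u : ℝ} (hu : 0 < u) (hu1 : u ≠ 1) :
    rieszKer 0 u = u * Real.log ((1 + u) / |1 - u|) := by
  have h0 : 0 < |1 - u| := abs_pos.2 (sub_ne_zero.2 hu1.symm)
  rw [rieszKer, ← integral_inv_of_pos h0 (by linarith)]
  simp [Real.rpow_neg_one]

lemma rieszKer_nonneg {s u : ℝ} (hu : 0 ≤ u) : 0 ≤ rieszKer s u := by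
  refine mul_nonneg hu (intervalIntegral.integral_nonneg ?_ fun v hv => ?_)
  · rw [abs_le]; constructor <;> linarith
  · exact Real.rpow_nonneg ((abs_nonneg _).trans hv.1) _

lemma intervalIntegrable_rpow_of_pos {a b r : ℝ} (ha : 0 < a) (hab : a ≤ b) :
    IntervalIntegrable (fun v : ℝ => v ^ r) volume a b := by
  refine intervalIntegral.intervalIntegrable_rpow (Or.inr fun h => ?_)
  rw [uIcc_of_le hab] at h
  exact absurd h.1 (not_le.2 ha)

lemma rieszKer_pos {s u : ℝ} (hu : 0 < u) (hu1 : u ≠ 1) : 0 < rieszKer s u := by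
  have h0 : 0 < |1 - u| := abs_pos.2 (sub_ne_zero.2 hu1.symm)
  have h1 := abs_one_sub_lt_one_add hu
  exact mul_pos hu (intervalIntegral.intervalIntegral_pos_of_pos_on
    (intervalIntegrable_rpow_of_pos h0 h1.le)
    (fun v hv => Real.rpow_pos_of_pos (h0.trans hv.1) _) h1)

lemma rieszKer_le {s u : ℝ} (hs : -1 < s) (hs1 : s < 1) (hu : 0 < u) (hu1 : u ≤ 1 / 2) :
    rieszKer s u ≤ 8 * u * u ^ s := by
  have habs : |1 - u| = 1 - u := abs_of_pos (by linarith)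
  have hbound : ∫ v in (1 - u)..(1 + u), v ^ (s - 1) ≤ ∫ v in (1 - u)..(1 + u), (4 : ℝ) := by
    refine intervalIntegral.integral_mono_on (by linarith)
      (intervalIntegrable_rpow_of_pos (by linarith) (by linarith)) (by simp) fun v hv => ?_
    calc v ^ (s - 1) ≤ (1 / 2 : ℝ) ^ (s - 1) :=
          Real.rpow_le_rpow_of_nonpos (by norm_num) (by linarith [hv.1]) (by linarith)
      _ ≤ (1 / 2 : ℝ) ^ (-2 : ℝ) :=
          Real.rpow_le_rpow_of_exponent_ge (by norm_num) (by norm_num) (by linarith)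
      _ = 4 := by
          rw [Real.rpow_neg (by norm_num)]; norm_num
  have hus : u ≤ u ^ s := by
    conv_lhs => rw [← Real.rpow_one u]
    exact Real.rpow_le_rpow_of_exponent_ge hu (by linarith) hs1.le
  rw [intervalIntegral.integral_const, smul_eq_mul] at hbound
  rw [rieszKer, habs]
  nlinarith [mul_le_mul_of_nonneg_left hbound hu.le, mul_le_mul_of_nonneg_left hus hu.le]

lemma rieszKer_div_mono {s u w : ℝ} (hs1 : s < 1) (hu : 0 < u) (huw : u ≤ w) (hw : w < 1) :
    rieszKer s u / u ^ s ≤ rieszKer s w / w ^ s := by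
  have key : ∀ y : ℝ, 0 < y → y < 1 →
      rieszKer s y / y ^ s = y ^ (1 - s) * ∫ v in (1 - y)..(1 + y), v ^ (s - 1) := by
    intro y hy hy1
    rw [rieszKer, abs_of_pos (by linarith : 0 < 1 - y), Real.rpow_sub hy, Real.rpow_one]
    ring
  rw [key u hu (by linarith), key w (by linarith) hw]
  refine mul_le_mul (Real.rpow_le_rpow hu.le huw (by linarith)) ?_ ?_
    (Real.rpow_nonneg (by linarith) _)
  · refine intervalIntegral.integral_mono_interval (by linarith) (by linarith) (by linarith) ?_
      (intervalIntegrable_rpow_of_pos (by linarith) (by linarith))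
    refine (ae_restrict_iff' measurableSet_Ioc).2 (Eventually.of_forall fun v hv => ?_)
    exact Real.rpow_nonneg (by linarith [hv.1]) _
  · exact intervalIntegral.integral_nonneg (by linarith) fun v hv =>
      Real.rpow_nonneg (by linarith [hv.1]) _

lemma one_add_mul_sub_one_le_rpow {p x : ℝ} (hp : p ≤ 0) (hx : 0 < x) :
    1 + p * (x - 1) ≤ x ^ p := by
  rw [Real.rpow_def_of_pos hx]
  nlinarith [Real.add_one_le_exp (Real.log x * p), Real.log_le_sub_one_of_pos hx]

lemma two_mul_rpow_le_rieszKer {s u : ℝ} (hs1 : s < 1) (hu : 1 < u) :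
    2 * u ^ s ≤ rieszKer s u := by
  have hu0 : 0 < u := by linarith
  have habs : |1 - u| = u - 1 := by rw [abs_sub_comm]; exact abs_of_pos (by linarith)
  have hlow : ∫ v in (u - 1)..(1 + u), u ^ (s - 1) * (1 + (s - 1) * (v / u - 1)) ≤
      ∫ v in (u - 1)..(1 + u), v ^ (s - 1) := by
    refine intervalIntegral.integral_mono_on (by linarith)
      (Continuous.intervalIntegrable (by fun_prop) _ _)
      (intervalIntegrable_rpow_of_pos (by linarith) (by linarith)) fun v hv => ?_
    have hv0 : 0 < v := by linarith [hv.1]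
    have h := one_add_mul_sub_one_le_rpow (p := s - 1) (by linarith) (div_pos hv0 hu0)
    calc _ ≤ u ^ (s - 1) * (v / u) ^ (s - 1) :=
          mul_le_mul_of_nonneg_left h (Real.rpow_nonneg hu0.le _)
      _ = v ^ (s - 1) := by
          rw [← Real.mul_rpow hu0.le (div_pos hv0 hu0).le, mul_div_cancel₀ _ hu0.ne']
  have hval : ∫ v in (u - 1)..(1 + u), u ^ (s - 1) * (1 + (s - 1) * (v / u - 1)) =
      2 * u ^ (s - 1) := by
    rw [intervalIntegral.integral_eq_sub_of_hasDerivAt (f := fun v =>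
      u ^ (s - 1) * (v + (s - 1) * (v ^ 2 / (2 * u) - v)))]
    · field_simp; ring
    · intro v _
      have h := (((hasDerivAt_id v).add (((((hasDerivAt_id v).pow 2).div_const (2 * u)).sub
        (hasDerivAt_id v)).const_mul (s - 1))).const_mul (u ^ (s - 1)))
      refine h.congr_deriv ?_
      simp only [id_eq]; push_cast; field_simp
    · exact Continuous.intervalIntegrable (by fun_prop) _ _
  rw [hval] at hlow
  rw [rieszKer, habs]
  calc 2 * u ^ s = u * (2 * u ^ (s - 1)) := by
        rw [Real.rpow_sub_one hu0.ne']; field_simp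
    _ ≤ _ := mul_le_mul_of_nonneg_left hlow hu0.le

/-- The rescaled kernel changes sign exactly once. -/
lemma exists_diffKer_sign_change {s : ℝ} (hs : -1 < s) (hs1 : s < 1) :
    ∃ u₀ : ℝ, 0 < u₀ ∧ (∀ u, 0 < u → u < u₀ → diffKer s u ≤ 0) ∧
      ∀ u, u₀ < u → u ≠ 1 → 0 ≤ diffKer s u := by
  set A : Set ℝ := {u | 0 < u ∧ u < 1 ∧ diffKer s u ≤ 0}
  have hmem : (1 / 4 : ℝ) ∈ A := by
    refine ⟨by norm_num, by norm_num, ?_⟩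
    have := rieszKer_le hs hs1 (u := 1 / 4) (by norm_num) (by norm_num)
    rw [diffKer]; linarith
  have hbdd : BddAbove A := ⟨1, fun u hu => hu.2.1.le⟩
  have hpos : 0 < sSup A := lt_of_lt_of_le (by norm_num) (le_csSup hbdd hmem)
  refine ⟨sSup A, hpos, ?_, ?_⟩
  · intro u hu hlt
    obtain ⟨w, hw, huw⟩ := exists_lt_of_lt_csSup ⟨_, hmem⟩ hlt
    have h := rieszKer_div_mono hs1 hu huw.le hw.2.1
    have h2 : rieszKer s w / w ^ s ≤ 2 := by
      rw [div_le_iff₀ (Real.rpow_pos_of_pos hw.1 _)]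
      have := hw.2.2
      rw [diffKer] at this; linarith
    have h3 := (div_le_iff₀ (Real.rpow_pos_of_pos hu _)).1 (h.trans h2)
    rw [diffKer]; linarith
  · intro u hu hne
    rcases lt_or_gt_of_ne hne with h1 | h1
    · by_contra! hneg
      exact absurd (le_csSup hbdd (⟨hpos.trans hu, h1, hneg.le⟩ : u ∈ A)) (not_le.2 hu)
    · rw [diffKer]; linarith [two_mul_rpow_le_rieszKer hs1 h1]

lemma diffKer_integral_of_primitives {s : ℝ} (hs : -1 < s) (hs1 : s < 1) {F₁ F₂ : ℝ → ℝ}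
    (hc₁ : ContinuousOn F₁ (Icc 0 1)) (hc₂ : ContinuousWithinAt F₂ (Ici 1) 1)
    (hd₁ : ∀ u ∈ Ioo (0 : ℝ) 1, HasDerivAt F₁ (diffKer s u) u)
    (hd₂ : ∀ u ∈ Ioi (1 : ℝ), HasDerivAt F₂ (diffKer s u) u)
    (h0 : F₁ 0 = 0) (h1 : F₁ 1 = F₂ 1) (hlim : Tendsto F₂ atTop (nhds 0)) :
    IntegrableOn (diffKer s) (Ioi 0) ∧ ∫ u in Ioi (0 : ℝ), diffKer s u = 0 := by
  have hpow : IntegrableOn (fun u : ℝ => 2 * u ^ s) (Ioc 0 1) :=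
    ((intervalIntegrable_iff_integrableOn_Ioc_of_le zero_le_one).1
      (intervalIntegral.intervalIntegrable_rpow' hs)).const_mul 2
  have hker : IntegrableOn (rieszKer s) (Ioc 0 1) := by
    refine intervalIntegral.integrableOn_deriv_of_nonneg
      (g := fun u => F₁ u + 2 * (u ^ (s + 1) / (s + 1))) ?_ (fun u hu => ?_)
      (fun u hu => rieszKer_nonneg hu.1.le)
    · exact hc₁.add (((Real.continuous_rpow_const (by linarith)).div_const _).const_mul
        2).continuousOn
    · have h := (hd₁ u hu).add ((((hasDerivAt_id u).rpow_const (p := s + 1)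
        (Or.inl hu.1.ne')).div_const (s + 1)).const_mul 2)
      refine h.congr_deriv ?_
      have : s + 1 ≠ 0 := by linarith
      simp [diffKer]
      field_simp
      ring
  have hi₁ : IntegrableOn (diffKer s) (Ioc 0 1) := hker.sub hpow
  have hnn : ∀ u ∈ Ioi (1 : ℝ), 0 ≤ diffKer s u := fun u hu =>
    sub_nonneg.2 (two_mul_rpow_le_rieszKer hs1 hu)
  have hi₂ : IntegrableOn (diffKer s) (Ioi 1) :=
    integrableOn_Ioi_deriv_of_nonneg hc₂ hd₂ hnn hlim
  have hv₁ : ∫ u in Ioc (0 : ℝ) 1, diffKer s u = F₁ 1 := by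
    rw [← intervalIntegral.integral_of_le zero_le_one,
      intervalIntegral.integral_eq_sub_of_hasDerivAt_of_le zero_le_one hc₁ hd₁
        ((intervalIntegrable_iff_integrableOn_Ioc_of_le zero_le_one).2 hi₁), h0, sub_zero]
  have hv₂ := integral_Ioi_of_hasDerivAt_of_tendsto hc₂ hd₂ hi₂ hlim
  rw [← Ioc_union_Ioi_eq_Ioi (zero_le_one' ℝ)]
  refine ⟨hi₁.union hi₂, ?_⟩
  rw [setIntegral_union (Ioc_disjoint_Ioi le_rfl) measurableSet_Ioi hi₁ hi₂, hv₁, hv₂, h1]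
  ring

lemma abs_rpow_add_sub_rpow_sub_le {s u t : ℝ} (hs1 : s < 1) (hu : 1 < u) (ht : t ∈ Icc (0 : ℝ) 1) :
    |(u + t) ^ s - (u - t) ^ s| ≤ 2 * |s| * (u - 1) ^ (s - 1) := by
  have h := (convex_Icc (u - 1) (u + 1)).norm_image_sub_le_of_norm_hasDerivWithin_le
    (f := fun v : ℝ => v ^ s) (f' := fun v => s * v ^ (s - 1)) (C := |s| * (u - 1) ^ (s - 1))
    (x := u - t) (y := u + t)
    (fun v hv => (Real.hasDerivAt_rpow_const
      (Or.inl (by linarith [hv.1] : (0 : ℝ) < v).ne')).hasDerivWithinAt)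
    (fun v hv => by
      rw [norm_mul, Real.norm_eq_abs, Real.norm_eq_abs,
        abs_of_nonneg (Real.rpow_nonneg (by linarith [hv.1]) _)]
      exact mul_le_mul_of_nonneg_left
        (Real.rpow_le_rpow_of_nonpos (by linarith) hv.1 (by linarith)) (abs_nonneg s))
    ⟨by linarith [ht.2], by linarith [ht.1]⟩ ⟨by linarith [ht.1], by linarith [ht.2]⟩
  simp only [Real.norm_eq_abs] at h
  refine h.trans ?_
  have h2 : |u + t - (u - t)| ≤ 2 := by
    rw [abs_le]; constructor <;> linarith [ht.1, ht.2]
  have := mul_le_mul_of_nonneg_left h2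
    (mul_nonneg (abs_nonneg s) (Real.rpow_nonneg (by linarith : 0 ≤ u - 1) (s - 1)))
  linarith

lemma abs_second_difference_rpow_le {s u t : ℝ} (hs : -1 < s) (hs1 : s < 1) (hu : 1 < u)
    (ht : t ∈ Icc (0 : ℝ) 1) :
    |(u + t) ^ (s + 1) + (u - t) ^ (s + 1) - 2 * u ^ (s + 1)| ≤
      (s + 1) * (2 * |s| * (u - 1) ^ (s - 1)) := by
  have h := (convex_Icc (0 : ℝ) 1).norm_image_sub_le_of_norm_hasDerivWithin_le
    (f := fun t : ℝ => (u + t) ^ (s + 1) + (u - t) ^ (s + 1) - 2 * u ^ (s + 1))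
    (f' := fun t => (s + 1) * ((u + t) ^ s - (u - t) ^ s))
    (C := (s + 1) * (2 * |s| * (u - 1) ^ (s - 1))) (x := 0) (y := t)
    (fun v hv => by
      have h1 := (((hasDerivAt_id v).const_add u).rpow_const (p := s + 1)
        (Or.inl (by simp only [id]; linarith [hv.1]))).add
        (((hasDerivAt_id v).const_sub u).rpow_const (p := s + 1)
        (Or.inl (by simp only [id]; linarith [hv.2])))
      refine ((h1.sub_const (2 * u ^ (s + 1))).congr_deriv ?_).hasDerivWithinAt
      simp only [id, add_sub_cancel_right]; ring)
    (fun v hv => by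
      rw [norm_mul, Real.norm_eq_abs, Real.norm_eq_abs, abs_of_pos (by linarith : 0 < s + 1)]
      exact mul_le_mul_of_nonneg_left (abs_rpow_add_sub_rpow_sub_le hs1 hu hv) (by linarith))
    ⟨le_rfl, zero_le_one⟩ ht
  simp only [Real.norm_eq_abs, add_zero, sub_zero] at h
  rw [show u ^ (s + 1) + u ^ (s + 1) - 2 * u ^ (s + 1) = 0 by ring, sub_zero] at h
  refine h.trans (mul_le_of_le_one_right ?_ ?_)
  · have := Real.rpow_nonneg (by linarith : 0 ≤ u - 1) (s - 1)
    have : 0 ≤ s + 1 := by linarith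
    positivity
  · rw [abs_of_nonneg ht.1]; exact ht.2

lemma abs_third_difference_rpow_le {s u : ℝ} (hs : -1 < s) (hs1 : s < 1) (hu : 1 < u) :
    |(u + 1) ^ (s + 2) - (u - 1) ^ (s + 2) - 2 * (s + 2) * u ^ (s + 1)| ≤
      (s + 2) * ((s + 1) * (2 * |s| * (u - 1) ^ (s - 1))) := by
  have h := (convex_Icc (0 : ℝ) 1).norm_image_sub_le_of_norm_hasDerivWithin_le
    (f := fun t : ℝ => (u + t) ^ (s + 2) - (u - t) ^ (s + 2) - 2 * (s + 2) * u ^ (s + 1) * t)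
    (f' := fun t => (s + 2) * ((u + t) ^ (s + 1) + (u - t) ^ (s + 1) - 2 * u ^ (s + 1)))
    (C := (s + 2) * ((s + 1) * (2 * |s| * (u - 1) ^ (s - 1)))) (x := 0) (y := 1)
    (fun v hv => by
      have h1 := (((hasDerivAt_id v).const_add u).rpow_const (p := s + 2)
        (Or.inl (by simp only [id]; linarith [hv.1]))).sub
        (((hasDerivAt_id v).const_sub u).rpow_const (p := s + 2)
        (Or.inl (by simp only [id]; linarith [hv.2])))
      refine ((h1.sub ((hasDerivAt_id v).const_mul
        (2 * (s + 2) * u ^ (s + 1)))).congr_deriv ?_).hasDerivWithinAt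
      simp only [id, show s + 2 - 1 = s + 1 by ring]; ring)
    (fun v hv => by
      rw [norm_mul, Real.norm_eq_abs, Real.norm_eq_abs, abs_of_pos (by linarith : 0 < s + 2)]
      exact mul_le_mul_of_nonneg_left (abs_second_difference_rpow_le hs hs1 hu hv) (by linarith))
    ⟨le_rfl, zero_le_one⟩ ⟨zero_le_one, le_rfl⟩
  simpa using h

lemma tendsto_sub_one_rpow_atTop {s : ℝ} (hs1 : s < 1) :
    Tendsto (fun u : ℝ => (u - 1) ^ (s - 1)) atTop (nhds 0) := by
  have h := (tendsto_rpow_neg_atTop (by linarith : 0 < 1 - s)).comp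
    (tendsto_atTop_add_const_right atTop (-1 : ℝ) tendsto_id)
  refine h.congr fun u => ?_
  simp [sub_eq_add_neg]

lemma tendsto_primitive_of_ne {s : ℝ} (hs : -1 < s) (hs1 : s < 1) (hs0 : s ≠ 0) :
    Tendsto (fun u : ℝ => (((u + 1) ^ (s + 2) - (u - 1) ^ (s + 2)) / (s + 2) -
      ((u + 1) ^ (s + 1) + (u - 1) ^ (s + 1)) / (s + 1)) / s - 2 * (u ^ (s + 1) / (s + 1)))
      atTop (nhds 0) := by
  have hlim : ∀ c : ℝ, Tendsto (fun u : ℝ => c * (2 * |s| * (u - 1) ^ (s - 1))) atTop (nhds 0) := by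
    intro c
    simpa using ((tendsto_sub_one_rpow_atTop hs1).const_mul (2 * |s|)).const_mul c
  have h2 : Tendsto (fun u : ℝ => (u + 1) ^ (s + 1) + (u - 1) ^ (s + 1) - 2 * u ^ (s + 1))
      atTop (nhds 0) := by
    refine squeeze_zero_norm' ?_ (hlim (s + 1))
    filter_upwards [eventually_gt_atTop 1] with u hu
    exact abs_second_difference_rpow_le hs hs1 hu ⟨zero_le_one, le_rfl⟩
  have h3 : Tendsto (fun u : ℝ => (u + 1) ^ (s + 2) - (u - 1) ^ (s + 2) -
      2 * (s + 2) * u ^ (s + 1)) atTop (nhds 0) := by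
    refine squeeze_zero_norm' ?_ (by simpa [mul_assoc] using hlim ((s + 2) * (s + 1)))
    filter_upwards [eventually_gt_atTop 1] with u hu
    simpa [mul_assoc] using abs_third_difference_rpow_le hs hs1 hu
  have h := ((h3.div_const (s + 2)).sub (h2.div_const (s + 1))).div_const s
  have e1 : s + 1 ≠ 0 := by linarith
  have e2 : s + 2 ≠ 0 := by linarith
  simp only [zero_div, sub_zero] at h
  refine h.congr fun u => ?_
  field_simp
  ring

lemma diffKer_integral_of_ne {s : ℝ} (hs : -1 < s) (hs1 : s < 1) (hs0 : s ≠ 0) :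
    IntegrableOn (diffKer s) (Ioi 0) ∧ ∫ u in Ioi (0 : ℝ), diffKer s u = 0 := by
  have e1 : s + 1 ≠ 0 := by linarith
  have e2 : s + 2 ≠ 0 := by linarith
  have p1 : 0 ≤ s + 1 := by linarith
  have p2 : 0 ≤ s + 2 := by linarith
  have hdp : ∀ u p : ℝ, u ≠ 0 → HasDerivAt (fun u : ℝ => u ^ p) (p * u ^ (p - 1)) u :=
    fun u p hu => Real.hasDerivAt_rpow_const (Or.inl hu)
  have hda : ∀ u p : ℝ, u + 1 ≠ 0 →
      HasDerivAt (fun u : ℝ => (u + 1) ^ p) (p * (u + 1) ^ (p - 1)) u :=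
    fun u p hu => by
      simpa using ((hasDerivAt_id u).add_const 1).rpow_const (p := p) (Or.inl hu)
  have hpow : ∀ x : ℝ, 0 < x → x ^ (s + 1) = x * x ^ s := fun x hx => by
    rw [Real.rpow_add_one hx.ne', mul_comm]
  refine diffKer_integral_of_primitives hs hs1
    (F₁ := fun u => (((u + 1) ^ (s + 2) - (1 - u) ^ (s + 2)) / (s + 2) -
      ((u + 1) ^ (s + 1) - (1 - u) ^ (s + 1)) / (s + 1)) / s - 2 * (u ^ (s + 1) / (s + 1)))
    (F₂ := fun u => (((u + 1) ^ (s + 2) - (u - 1) ^ (s + 2)) / (s + 2) -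
      ((u + 1) ^ (s + 1) + (u - 1) ^ (s + 1)) / (s + 1)) / s - 2 * (u ^ (s + 1) / (s + 1)))
    ?_ ?_ ?_ ?_ ?_ ?_ (tendsto_primitive_of_ne hs hs1 hs0)
  · refine Continuous.continuousOn ?_
    fun_prop (disch := assumption)
  · refine Continuous.continuousWithinAt ?_
    fun_prop (disch := assumption)
  · intro u hu
    have hm : ∀ p : ℝ, HasDerivAt (fun u : ℝ => (1 - u) ^ p) (-(p * (1 - u) ^ (p - 1))) u :=
      fun p => by
        simpa using ((hasDerivAt_id u).const_sub 1).rpow_const (p := p)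
          (Or.inl (sub_ne_zero.2 hu.2.ne'))
    have h1 : u + 1 ≠ 0 := by linarith [hu.1]
    refine (((((hda u _ h1).sub (hm _)).div_const _).sub
      (((hda u _ h1).sub (hm _)).div_const _)).div_const s |>.sub
      (((hdp u _ hu.1.ne').div_const _).const_mul 2)).congr_deriv ?_
    rw [diffKer, rieszKer_of_ne hs0 hu.1 hu.2.ne, abs_of_pos (by linarith [hu.2] : 0 < 1 - u),
      show s + 2 - 1 = s + 1 by ring, show s + 1 - 1 = s by ring,
      hpow _ (by linarith [hu.1]), hpow (1 - u) (by linarith [hu.2]), add_comm 1 u]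
    field_simp
    ring
  · intro u hu
    have hu1 : 1 < u := hu
    have hm : ∀ p : ℝ, HasDerivAt (fun u : ℝ => (u - 1) ^ p) (p * (u - 1) ^ (p - 1)) u :=
      fun p => by
        simpa using ((hasDerivAt_id u).sub_const 1).rpow_const (p := p)
          (Or.inl (sub_ne_zero.2 hu1.ne'))
    have h1 : u + 1 ≠ 0 := by linarith
    refine (((((hda u _ h1).sub (hm _)).div_const _).sub
      (((hda u _ h1).add (hm _)).div_const _)).div_const s |>.sub
      (((hdp u _ (by linarith)).div_const _).const_mul 2)).congr_deriv ?_
    rw [diffKer, rieszKer_of_ne hs0 (by linarith) hu1.ne', abs_sub_comm,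
      abs_of_pos (by linarith : 0 < u - 1),
      show s + 2 - 1 = s + 1 by ring, show s + 1 - 1 = s by ring,
      hpow _ (by linarith), hpow (u - 1) (by linarith), add_comm 1 u]
    field_simp
    ring
  · simp [e1]
  · simp [e1, e2]

lemma diffKer_zero_integral :
    IntegrableOn (diffKer 0) (Ioi 0) ∧ ∫ u in Ioi (0 : ℝ), diffKer 0 u = 0 := by
  set F : ℝ → ℝ := fun u => (u ^ 2 - 1) / 2 * (Real.log (u + 1) - Real.log (u - 1)) - u with hF
  have hcont : ContinuousOn F (Ici 0) := by
    have h1 : ContinuousOn (fun u : ℝ => (u ^ 2 - 1) / 2 * Real.log (u + 1)) (Ici 0) :=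
      (by fun_prop : Continuous fun u : ℝ => (u ^ 2 - 1) / 2).continuousOn.mul
        (ContinuousOn.log (by fun_prop) fun u hu => by
          have : (0 : ℝ) ≤ u := hu
          linarith)
    have h2 : Continuous (fun u : ℝ => (u + 1) / 2 * ((u - 1) * Real.log (u - 1))) :=
      (by fun_prop : Continuous fun u : ℝ => (u + 1) / 2).mul
        (Real.continuous_mul_log.comp (continuous_id.sub continuous_const))
    refine ((h1.sub h2.continuousOn).sub continuousOn_id).congr fun u _ => ?_
    simp only [hF, Pi.sub_apply, id_eq]; ring
  have hker : ∀ u : ℝ, 0 < u → u ≠ 1 →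
      diffKer 0 u = u * (Real.log (u + 1) - Real.log (u - 1)) - 2 := by
    intro u hu hu1
    rw [diffKer, rieszKer_zero hu hu1, Real.log_div (by linarith)
      (abs_ne_zero.2 (sub_ne_zero.2 hu1.symm)), Real.log_abs, ← Real.log_neg_eq_log (1 - u),
      neg_sub, add_comm 1 u, Real.rpow_zero, mul_one]
  have hd : ∀ u : ℝ, 0 < u → u ≠ 1 → HasDerivAt F (diffKer 0 u) u := by
    intro u hu hu1
    have e1 : u - 1 ≠ 0 := sub_ne_zero.2 hu1
    have e2 : u + 1 ≠ 0 := by linarith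
    have h := ((((((hasDerivAt_id u).pow 2).sub_const 1).div_const 2).mul
      ((((hasDerivAt_id u).add_const 1).log e2).sub
        (((hasDerivAt_id u).sub_const 1).log e1))).sub (hasDerivAt_id u))
    refine h.congr_deriv ?_
    rw [hker u hu hu1]
    simp
    field_simp
    ring
  refine diffKer_integral_of_primitives (by norm_num) (by norm_num) (F₁ := F) (F₂ := F)
    (hcont.mono Icc_subset_Ici_self)
    (hcont.mono (Ici_subset_Ici.2 zero_le_one) 1 self_mem_Ici)
    (fun u hu => hd u hu.1 hu.2.ne)
    (fun u hu => hd u (zero_lt_one.trans hu) (ne_of_gt hu)) (by simp [hF]) rfl ?_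
  have hlow : ∀ u : ℝ, 1 < u → -u⁻¹ ≤ F u := by
    intro u hu
    have h := two_mul_rpow_le_rieszKer (s := 0) (by norm_num) hu
    have h' := hker u (by linarith) hu.ne'
    rw [diffKer] at h'
    have h3 : 2 * u⁻¹ ≤ Real.log (u + 1) - Real.log (u - 1) := by
      rw [← div_eq_mul_inv, div_le_iff₀ (by linarith)]
      rw [Real.rpow_zero] at h h'; linarith
    have h4 := mul_le_mul_of_nonneg_left h3 (by nlinarith : 0 ≤ (u ^ 2 - 1) / 2)
    have h5 : (u ^ 2 - 1) / 2 * (2 * u⁻¹) = u - u⁻¹ := by field_simp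
    simp only [hF]; linarith
  have hup : ∀ u : ℝ, 1 < u → F u ≤ 0 := by
    intro u hu
    have hr : 0 < (u + 1) / (u - 1) := div_pos (by linarith) (by linarith)
    have h1 : 1 ≤ (u + 1) / (u - 1) := by
      rw [le_div_iff₀ (by linarith)]; linarith
    have h := Real.self_le_sinh_iff.2 (Real.log_nonneg h1)
    have e1 : u - 1 ≠ 0 := by linarith
    have e2 : u + 1 ≠ 0 := by linarith
    rw [Real.sinh_log hr, Real.log_div e2 e1] at h
    have h4 := mul_le_mul_of_nonneg_left h (by nlinarith : 0 ≤ (u ^ 2 - 1) / 2)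
    have h5 : (u ^ 2 - 1) / 2 * (((u + 1) / (u - 1) - ((u + 1) / (u - 1))⁻¹) / 2) = u := by
      rw [inv_div]; field_simp; ring
    simp only [hF]; linarith
  refine squeeze_zero_norm' (a := fun u : ℝ => u⁻¹) ?_ tendsto_inv_atTop_zero
  filter_upwards [eventually_gt_atTop 1] with u hu
  rw [Real.norm_eq_abs, abs_of_nonpos (hup u hu)]
  linarith [hlow u hu]

lemma diffKer_integral {s : ℝ} (hs : -1 < s) (hs1 : s < 1) :
    IntegrableOn (diffKer s) (Ioi 0) ∧ ∫ u in Ioi (0 : ℝ), diffKer s u = 0 := by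
  rcases eq_or_ne s 0 with rfl | hs0
  · exact diffKer_zero_integral
  · exact diffKer_integral_of_ne hs hs1 hs0

lemma integrableOn_comp_mul_diffKer {s x : ℝ} (hs : -1 < s) (hs1 : s < 1) {g : ℝ → ℝ}
    (hgc : Continuous g) (hga : AntitoneOn g (Ici 0)) (hg0 : ∀ y ∈ Ici (0 : ℝ), 0 ≤ g y)
    (hx : 0 < x) : IntegrableOn (fun u => g (x * u) * diffKer s u) (Ioi 0) := by
  refine Integrable.bdd_mul (c := g 0) (diffKer_integral hs hs1).1
    (by fun_prop : Continuous fun u => g (x * u)).aestronglyMeasurable ?_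
  refine (ae_restrict_iff' measurableSet_Ioi).2 (Eventually.of_forall fun u hu => ?_)
  have hxu : x * u ∈ Ici (0 : ℝ) := (mul_pos hx hu).le
  rw [Real.norm_eq_abs, abs_of_nonneg (hg0 _ hxu)]
  exact hga self_mem_Ici hxu hxu

lemma integrableOn_mul_rpow_Ioc {s : ℝ} (hs : -1 < s) {g : ℝ → ℝ} (hgc : Continuous g) (R : ℝ) :
    IntegrableOn (fun y => g y * y ^ s) (Ioc 0 R) := by
  rcases le_total 0 R with hR | hR
  · exact (intervalIntegrable_iff_integrableOn_Ioc_of_le hR).1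
      ((intervalIntegral.intervalIntegrable_rpow' hs).continuousOn_mul hgc.continuousOn)
  · simp [Ioc_eq_empty_of_le hR]

lemma setIntegral_mul_rpow_scale {s x a : ℝ} (hx : 0 < x) (ha : 0 ≤ a) (g : ℝ → ℝ) :
    x ^ (s + 1) * ∫ u in Ioi a, g (x * u) * u ^ s = ∫ y in Ioi (x * a), g y * y ^ s := by
  have h := integral_comp_mul_left_Ioi (fun y => g y * y ^ s) a hx
  have h2 : ∫ u in Ioi a, g (x * u) * (x * u) ^ s = x ^ s * ∫ u in Ioi a, g (x * u) * u ^ s := by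
    rw [← integral_const_mul]
    refine setIntegral_congr_fun measurableSet_Ioi fun u hu => ?_
    simp only [Real.mul_rpow hx.le (ha.trans (le_of_lt hu))]
    ring
  rw [h2, smul_eq_mul] at h
  rw [Real.rpow_add_one hx.ne', mul_comm (x ^ s) x, mul_assoc, h, mul_inv_cancel_left₀ hx.ne']

lemma integrableOn_comp_mul_rpow {s x : ℝ} (hx : 0 < x) {g : ℝ → ℝ}
    (hgi : IntegrableOn (fun y => g y * y ^ s) (Ioi 0)) :
    IntegrableOn (fun u => g (x * u) * u ^ s) (Ioi 0) := by
  have h := (integrableOn_Ioi_comp_mul_left_iff (fun y => g y * y ^ s) 0 hx).2 (by simpa using hgi)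
  refine IntegrableOn.congr_fun (h.const_mul (x ^ s)⁻¹) (fun u hu => ?_) measurableSet_Ioi
  have := (Real.rpow_pos_of_pos hx s).ne'
  simp only [Real.mul_rpow hx.le (le_of_lt hu)]
  field_simp

/-- If the potential of a decreasing bounded function is bounded below, then the function
minus its limit is integrable against `y ^ s`. -/
lemma integrableOn_sub_limit_mul_rpow {s : ℝ} (hs : -1 < s) (hs1 : s < 1) {f : ℝ → ℝ}
    (hfc : Continuous f) (hfa : AntitoneOn f (Ici 0)) (hf0 : ∀ y ∈ Ici (0 : ℝ), 0 ≤ f y)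
    {L : ℝ} (hL : Tendsto f atTop (nhds L)) (hLf : ∀ y ∈ Ici (0 : ℝ), L ≤ f y) {B : ℝ}
    (hB : ∀ x, 0 < x → -B ≤ x ^ (s + 1) * ∫ u in Ioi (0 : ℝ), f (x * u) * diffKer s u) :
    IntegrableOn (fun y => (f y - L) * y ^ s) (Ioi 0) := by
  obtain ⟨u₀, hu₀, hneg, hpos⟩ := exists_diffKer_sign_change hs hs1
  obtain ⟨hki, hk0⟩ := diffKer_integral hs hs1
  set δ : ℝ := min u₀ (1 / 8)
  have hδ0 : 0 < δ := lt_min hu₀ (by norm_num)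
  have hscaled : ∀ x, 0 < x →
      ∫ y in (0 : ℝ)..(x * δ), (f y - f (x * u₀)) * y ^ s ≤ B := by
    intro x hx
    have hint : IntegrableOn (fun u => (f (x * u₀) - f (x * u)) * diffKer s u) (Ioi 0) := by
      refine IntegrableOn.congr_fun ((hki.const_mul (f (x * u₀))).sub
        (integrableOn_comp_mul_diffKer hs hs1 hfc hfa hf0 hx)) (fun u _ => ?_) measurableSet_Ioi
      simp only [Pi.sub_apply]; ring
    have hval : ∫ u in Ioi (0 : ℝ), (f (x * u₀) - f (x * u)) * diffKer s u =
        -∫ u in Ioi (0 : ℝ), f (x * u) * diffKer s u := by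
      simp only [sub_mul]
      rw [integral_sub (hki.const_mul (f (x * u₀)))
        (integrableOn_comp_mul_diffKer hs hs1 hfc hfa hf0 hx), integral_const_mul, hk0]
      ring
    have hnn : 0 ≤ᵐ[volume.restrict (Ioi (0 : ℝ))]
        fun u => (f (x * u₀) - f (x * u)) * diffKer s u := by
      have hne : ∀ᵐ u : ℝ, u ≠ 1 := by simp [ae_iff]
      refine (ae_restrict_iff' measurableSet_Ioi).2 ?_
      filter_upwards [hne] with u hu1 hu
      have hu' : (0 : ℝ) < u := hu
      have h1 : x * u ∈ Ici (0 : ℝ) := (mul_pos hx hu').le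
      have h2 : x * u₀ ∈ Ici (0 : ℝ) := (mul_pos hx hu₀).le
      rcases lt_trichotomy u u₀ with h | h | h
      · exact mul_nonneg_of_nonpos_of_nonpos
          (sub_nonpos.2 (hfa h1 h2 (mul_le_mul_of_nonneg_left h.le hx.le))) (hneg u hu' h)
      · simp [h]
      · exact mul_nonneg
          (sub_nonneg.2 (hfa h2 h1 (mul_le_mul_of_nonneg_left h.le hx.le))) (hpos u h hu1)
    have hle : ∫ u in Ioc 0 δ, (f (x * u) - f (x * u₀)) * u ^ s ≤
        ∫ u in Ioi (0 : ℝ), (f (x * u₀) - f (x * u)) * diffKer s u := by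
      refine le_trans ?_ (setIntegral_mono_set hint hnn
        (Ioc_subset_Ioi_self : Ioc 0 δ ⊆ Ioi 0).eventuallyLE)
      refine setIntegral_mono_on
        (integrableOn_mul_rpow_Ioc hs (g := fun u => f (x * u) - f (x * u₀)) (by fun_prop) δ)
        (hint.mono_set Ioc_subset_Ioi_self) measurableSet_Ioc fun u hu => ?_
      have h8 : u ≤ 1 / 8 := hu.2.trans (min_le_right _ _)
      have h1 := rieszKer_le hs hs1 hu.1 (by linarith)
      have hp := Real.rpow_nonneg hu.1.le s
      have h2 : diffKer s u ≤ -u ^ s := by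
        rw [diffKer]
        nlinarith
      have h3 : f (x * u₀) ≤ f (x * u) := hfa (mul_pos hx hu.1).le (mul_pos hx hu₀).le
        (mul_le_mul_of_nonneg_left (hu.2.trans (min_le_left _ _)) hx.le)
      nlinarith
    have hsc : ∫ y in (0 : ℝ)..(x * δ), (f y - f (x * u₀)) * y ^ s =
        x ^ (s + 1) * ∫ u in Ioc 0 δ, (f (x * u) - f (x * u₀)) * u ^ s := by
      have h := intervalIntegral.mul_integral_comp_mul_left (a := 0) (b := δ)
        (f := fun y => (f y - f (x * u₀)) * y ^ s) x
      rw [mul_zero] at h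
      rw [← h, intervalIntegral.integral_of_le hδ0.le, Real.rpow_add_one hx.ne',
        mul_comm (x ^ s) x, mul_assoc]
      congr 1
      rw [← integral_const_mul]
      refine setIntegral_congr_fun measurableSet_Ioc fun u hu => ?_
      simp only [Real.mul_rpow hx.le hu.1.le]
      ring
    have hBx := hB x hx
    rw [hval] at hle
    have := mul_le_mul_of_nonneg_left hle (Real.rpow_nonneg hx.le (s + 1))
    rw [hsc]
    linarith
  have hii : ∀ c R : ℝ, IntervalIntegrable (fun y => (f y - c) * y ^ s) volume 0 R := fun c R =>
    (intervalIntegral.intervalIntegrable_rpow' hs).continuousOn_mul (by fun_prop)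
  have hsplit : ∀ c R : ℝ, ∫ y in (0 : ℝ)..R, (f y - c) * y ^ s =
      (∫ y in (0 : ℝ)..R, f y * y ^ s) - c * ∫ y in (0 : ℝ)..R, y ^ s := by
    intro c R
    simp only [sub_mul]
    rw [intervalIntegral.integral_sub (by simpa using hii 0 R)
      ((intervalIntegral.intervalIntegrable_rpow' hs).const_mul c),
      intervalIntegral.integral_const_mul]
  have hbound : ∀ R : ℝ, 0 ≤ R → ∫ y in (0 : ℝ)..R, (f y - L) * y ^ s ≤ B := by
    intro R hR
    rw [hsplit]
    have hlim : Tendsto (fun x : ℝ => (∫ y in (0 : ℝ)..R, f y * y ^ s) -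
        f (x * u₀) * ∫ y in (0 : ℝ)..R, y ^ s) atTop
        (nhds ((∫ y in (0 : ℝ)..R, f y * y ^ s) - L * ∫ y in (0 : ℝ)..R, y ^ s)) :=
      tendsto_const_nhds.sub
        ((hL.comp (tendsto_id.atTop_mul_const hu₀)).mul_const _)
    refine le_of_tendsto hlim ?_
    filter_upwards [eventually_gt_atTop 0, eventually_ge_atTop (R / δ),
      eventually_ge_atTop (R / u₀)] with x hx hxδ hxu
    rw [div_le_iff₀ hδ0] at hxδ
    refine le_trans ?_ (hscaled x hx)
    rw [← hsplit]
    have hδu : x * δ ≤ x * u₀ := mul_le_mul_of_nonneg_left (min_le_left _ _) hx.le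
    refine intervalIntegral.integral_mono_interval le_rfl hR hxδ ?_ (hii _ _)
    refine (ae_restrict_iff' measurableSet_Ioc).2 (Eventually.of_forall fun y hy => ?_)
    exact mul_nonneg (sub_nonneg.2 (hfa hy.1.le (mul_pos hx hu₀).le (hy.2.trans hδu)))
      (Real.rpow_nonneg hy.1.le s)
  refine integrableOn_Ioi_of_intervalIntegral_norm_bounded B 0 (b := id) (l := atTop)
    (fun R => integrableOn_mul_rpow_Ioc hs (g := fun y => f y - L) (by fun_prop) R) tendsto_id ?_
  filter_upwards [eventually_ge_atTop 0] with R hR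
  refine le_of_eq_of_le (intervalIntegral.integral_congr fun y hy => ?_) (hbound R hR)
  rw [id, uIcc_of_le hR] at hy
  exact Real.norm_of_nonneg
    (mul_nonneg (sub_nonneg.2 (hLf y hy.1)) (Real.rpow_nonneg hy.1 s))

/-- The Riesz potential of `g`, in rescaled form. -/
def rieszPot (s : ℝ) (g : ℝ → ℝ) (x : ℝ) : ℝ :=
  x ^ (s + 1) * ∫ u in Ioi (0 : ℝ), g (x * u) * rieszKer s u

/-- A continuous nonnegative function, non-increasing on `[0,∞)` and integrable against
`y ^ s` there. -/
structure IsProfile (s : ℝ) (g : ℝ → ℝ) : Prop where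
  continuous : Continuous g
  antitoneOn : AntitoneOn g (Ici 0)
  nonneg : ∀ y ∈ Ici (0 : ℝ), 0 ≤ g y
  integrableOn : IntegrableOn (fun y => g y * y ^ s) (Ioi 0)

lemma IsProfile.integrableOn_rieszKer {s x : ℝ} (hs : -1 < s) (hs1 : s < 1) {g : ℝ → ℝ}
    (hg : IsProfile s g) (hx : 0 < x) :
    IntegrableOn (fun u => g (x * u) * rieszKer s u) (Ioi 0) := by
  refine IntegrableOn.congr_fun
    ((integrableOn_comp_mul_diffKer hs hs1 hg.continuous hg.antitoneOn hg.nonneg hx).add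
      ((integrableOn_comp_mul_rpow hx hg.integrableOn).const_mul 2)) (fun u _ => ?_)
    measurableSet_Ioi
  simp only [diffKer, Pi.add_apply]; ring

lemma IsProfile.integral_diffKer {s x : ℝ} (hs : -1 < s) (hs1 : s < 1) {g : ℝ → ℝ}
    (hg : IsProfile s g) (hx : 0 < x) :
    x ^ (s + 1) * ∫ u in Ioi (0 : ℝ), g (x * u) * diffKer s u =
      rieszPot s g x - 2 * ∫ y in Ioi (0 : ℝ), g y * y ^ s := by
  have h : ∫ u in Ioi (0 : ℝ), g (x * u) * diffKer s u =
      (∫ u in Ioi (0 : ℝ), g (x * u) * rieszKer s u) -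
        2 * ∫ u in Ioi (0 : ℝ), g (x * u) * u ^ s := by
    rw [← integral_const_mul, ← integral_sub (hg.integrableOn_rieszKer hs hs1 hx)
      ((integrableOn_comp_mul_rpow hx hg.integrableOn).const_mul 2)]
    refine setIntegral_congr_fun measurableSet_Ioi fun u _ => ?_
    simp only [diffKer]; ring
  have h2 := setIntegral_mul_rpow_scale (s := s) hx le_rfl g
  rw [mul_zero] at h2
  rw [h, rieszPot, ← h2]
  ring

lemma IsProfile.tendsto_rpow_mul {s : ℝ} (hs : -1 < s) {g : ℝ → ℝ} (hg : IsProfile s g) :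
    Tendsto (fun x => x ^ (s + 1) * g x) atTop (nhds 0) := by
  set κ : ℝ := ∫ u in Ioc (1 / 2 : ℝ) 1, u ^ s with hκ
  have hκi : IntegrableOn (fun u : ℝ => u ^ s) (Ioc (1 / 2 : ℝ) 1) :=
    (intervalIntegrable_iff_integrableOn_Ioc_of_le (by norm_num)).1
      (intervalIntegral.intervalIntegrable_rpow' hs)
  have hκ0 : 0 < κ := by
    rw [hκ, ← intervalIntegral.integral_of_le (by norm_num)]
    exact intervalIntegral.intervalIntegral_pos_of_pos_on
      (intervalIntegral.intervalIntegrable_rpow' hs)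
      (fun u hu => Real.rpow_pos_of_pos (by linarith [hu.1]) s) (by norm_num)
  have htail : Tendsto (fun x : ℝ => κ⁻¹ * ∫ y in Ioi (x * (1 / 2)), g y * y ^ s)
      atTop (nhds 0) := by
    simpa using (tendsto_integral_Ioi_zero (μ := volume) (f := fun y => g y * y ^ s)
      (tendsto_id.atTop_mul_const (by norm_num : (0 : ℝ) < 1 / 2))).const_mul κ⁻¹
  refine squeeze_zero_norm' ?_ htail
  filter_upwards [eventually_gt_atTop 0] with x hx
  have hgx := hg.nonneg x hx.le
  have hxp := Real.rpow_nonneg hx.le (s + 1)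
  rw [Real.norm_of_nonneg (mul_nonneg hxp hgx),
    ← setIntegral_mul_rpow_scale hx (by norm_num), ← div_eq_inv_mul, le_div_iff₀ hκ0, mul_assoc]
  refine mul_le_mul_of_nonneg_left ?_ hxp
  have hi := (integrableOn_comp_mul_rpow hx hg.integrableOn).mono_set
    (Ioi_subset_Ioi (by norm_num : (0 : ℝ) ≤ 1 / 2))
  calc g x * κ = ∫ u in Ioc (1 / 2 : ℝ) 1, g x * u ^ s := by rw [integral_const_mul]
    _ ≤ ∫ u in Ioc (1 / 2 : ℝ) 1, g (x * u) * u ^ s := by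
        refine setIntegral_mono_on (hκi.const_mul _) (hi.mono_set Ioc_subset_Ioi_self)
          measurableSet_Ioc fun u hu => ?_
        have hu0 : 0 < u := by linarith [hu.1]
        exact mul_le_mul_of_nonneg_right (hg.antitoneOn (mul_pos hx hu0).le hx.le
          (mul_le_of_le_one_right hx.le hu.2)) (Real.rpow_nonneg hu0.le s)
    _ ≤ _ := by
        refine setIntegral_mono_set hi ?_ Ioc_subset_Ioi_self.eventuallyLE
        refine (ae_restrict_iff' measurableSet_Ioi).2 (Eventually.of_forall fun u hu => ?_)
        have hu0 : 0 < u := by linarith [mem_Ioi.1 hu]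
        exact mul_nonneg (hg.nonneg _ (mul_pos hx hu0).le) (Real.rpow_nonneg hu0.le s)

lemma IsProfile.rieszPot_le {s x δ : ℝ} (hs : -1 < s) (hs1 : s < 1) {g : ℝ → ℝ}
    (hg : IsProfile s g) (hx : 0 < x) (hδ : 0 < δ) (hδ1 : δ ≤ 1 / 2) :
    rieszPot s g x ≤ 8 * δ * (∫ y in Ioi (0 : ℝ), g y * y ^ s) +
      ((∫ u in Ioi δ, |diffKer s u|) * (x ^ (s + 1) * g (x * δ)) +
        2 * ∫ y in Ioi (x * δ), g y * y ^ s) := by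
  have hRi := hg.integrableOn_rieszKer hs hs1 hx
  have hpi := integrableOn_comp_mul_rpow hx hg.integrableOn
  have hsub : Ioi δ ⊆ Ioi (0 : ℝ) := Ioi_subset_Ioi hδ.le
  have hki : IntegrableOn (fun u => |diffKer s u|) (Ioi δ) :=
    ((diffKer_integral hs hs1).1.mono_set hsub).abs
  have h1 : ∫ u in Ioc 0 δ, g (x * u) * rieszKer s u ≤
      8 * δ * ∫ u in Ioi (0 : ℝ), g (x * u) * u ^ s := by
    calc _ ≤ ∫ u in Ioc 0 δ, 8 * δ * (g (x * u) * u ^ s) := by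
          refine setIntegral_mono_on (hRi.mono_set Ioc_subset_Ioi_self)
            ((hpi.mono_set Ioc_subset_Ioi_self).const_mul _) measurableSet_Ioc fun u hu => ?_
          have hgu := hg.nonneg _ (mul_pos hx hu.1).le
          have hr := rieszKer_le hs hs1 hu.1 (hu.2.trans hδ1)
          have hp := Real.rpow_nonneg hu.1.le s
          have : rieszKer s u ≤ 8 * δ * u ^ s := hr.trans
            (mul_le_mul_of_nonneg_right (by linarith [hu.2]) hp)
          calc _ ≤ g (x * u) * (8 * δ * u ^ s) := mul_le_mul_of_nonneg_left this hgu
            _ = _ := by ring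
      _ = 8 * δ * ∫ u in Ioc 0 δ, g (x * u) * u ^ s := integral_const_mul _ _
      _ ≤ _ := by
          refine mul_le_mul_of_nonneg_left (setIntegral_mono_set hpi ?_
            Ioc_subset_Ioi_self.eventuallyLE) (by linarith)
          refine (ae_restrict_iff' measurableSet_Ioi).2 (Eventually.of_forall fun u hu => ?_)
          exact mul_nonneg (hg.nonneg _ (mul_pos hx hu).le) (Real.rpow_nonneg (le_of_lt hu) s)
  have h2 : ∫ u in Ioi δ, g (x * u) * rieszKer s u ≤
      g (x * δ) * (∫ u in Ioi δ, |diffKer s u|) + 2 * ∫ u in Ioi δ, g (x * u) * u ^ s := by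
    rw [← integral_const_mul, ← integral_const_mul,
      ← integral_add (hki.const_mul _) ((hpi.mono_set hsub).const_mul 2)]
    refine setIntegral_mono_on (hRi.mono_set hsub)
      ((hki.const_mul _).add ((hpi.mono_set hsub).const_mul 2)) measurableSet_Ioi fun u hu => ?_
    have hu0 : 0 < u := hδ.trans hu
    have hgu := hg.nonneg _ (mul_pos hx hu0).le
    have hgle : g (x * u) ≤ g (x * δ) := hg.antitoneOn (mul_pos hx hδ).le (mul_pos hx hu0).le
      (mul_le_mul_of_nonneg_left (le_of_lt hu) hx.le)
    calc g (x * u) * rieszKer s u = g (x * u) * diffKer s u + 2 * (g (x * u) * u ^ s) := by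
          rw [diffKer]; ring
      _ ≤ _ := by
          refine add_le_add ?_ le_rfl
          exact (mul_le_mul_of_nonneg_left (le_abs_self _) hgu).trans
            (mul_le_mul_of_nonneg_right hgle (abs_nonneg _))
  have hsplit : ∫ u in Ioi (0 : ℝ), g (x * u) * rieszKer s u =
      (∫ u in Ioc 0 δ, g (x * u) * rieszKer s u) + ∫ u in Ioi δ, g (x * u) * rieszKer s u := by
    rw [← Ioc_union_Ioi_eq_Ioi hδ.le, setIntegral_union (Ioc_disjoint_Ioi le_rfl)
      measurableSet_Ioi (hRi.mono_set Ioc_subset_Ioi_self) (hRi.mono_set hsub)]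
  have hs0 := setIntegral_mul_rpow_scale (s := s) hx le_rfl g
  rw [mul_zero] at hs0
  rw [rieszPot, hsplit, ← hs0, ← setIntegral_mul_rpow_scale hx hδ.le]
  refine (mul_le_mul_of_nonneg_left (add_le_add h1 h2)
    (Real.rpow_nonneg hx.le (s + 1))).trans_eq ?_
  ring

lemma IsProfile.nonpos_of_le_rieszPot {s β : ℝ} (hs : -1 < s) (hs1 : s < 1) {g : ℝ → ℝ}
    (hg : IsProfile s g) (hβ : ∀ x, 0 < x → β ≤ rieszPot s g x) : β ≤ 0 := by
  set b : ℝ := ∫ y in Ioi (0 : ℝ), g y * y ^ s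
  have hδ : ∀ δ : ℝ, 0 < δ → δ ≤ 1 / 2 → β ≤ 8 * δ * b := by
    intro δ hδ hδ1
    have hscale : Tendsto (fun x : ℝ => x * δ) atTop atTop := tendsto_id.atTop_mul_const hδ
    have h1 : Tendsto (fun x : ℝ => x ^ (s + 1) * g (x * δ)) atTop (nhds 0) := by
      have h := ((hg.tendsto_rpow_mul hs).comp hscale).const_mul (δ ^ (s + 1))⁻¹
      rw [mul_zero] at h
      refine h.congr' ?_
      filter_upwards [eventually_gt_atTop 0] with x hx
      have := (Real.rpow_pos_of_pos hδ (s + 1)).ne'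
      simp only [Function.comp, Real.mul_rpow hx.le hδ.le]
      field_simp
    have h2 : Tendsto (fun x : ℝ => ∫ y in Ioi (x * δ), g y * y ^ s) atTop (nhds 0) :=
      tendsto_integral_Ioi_zero hscale
    have h := ((h1.const_mul (∫ u in Ioi δ, |diffKer s u|)).add (h2.const_mul 2)).const_add
      (8 * δ * b)
    simp only [mul_zero, add_zero] at h
    refine ge_of_tendsto h ?_
    filter_upwards [eventually_gt_atTop 0] with x hx
    exact (hβ x hx).trans (hg.rieszPot_le hs hs1 hx hδ hδ1)
  have hlim : Tendsto (fun δ : ℝ => 8 * δ * b) (nhdsWithin 0 (Ioi 0)) (nhds 0) := by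
    have : Tendsto (fun δ : ℝ => 8 * δ * b) (nhds 0) (nhds (8 * 0 * b)) :=
      (by fun_prop : Continuous fun δ : ℝ => 8 * δ * b).tendsto 0
    simp only [mul_zero, zero_mul] at this
    exact this.mono_left nhdsWithin_le_nhds
  refine ge_of_tendsto hlim ?_
  filter_upwards [Ioc_mem_nhdsGT (by norm_num : (0 : ℝ) < 1 / 2)] with δ h
  exact hδ δ h.1 h.2

lemma rieszKer_integrableOn_Ioc {s : ℝ} (hs : -1 < s) (hs1 : s < 1) (a : ℝ) :
    IntegrableOn (rieszKer s) (Ioc 0 a) := by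
  refine IntegrableOn.congr_fun
    (((diffKer_integral hs hs1).1.mono_set (Ioc_subset_Ioi_self : Ioc 0 a ⊆ Ioi 0)).add
      (integrableOn_mul_rpow_Ioc hs continuous_const a (g := fun _ => 2)))
    (fun u _ => ?_) measurableSet_Ioc
  simp only [diffKer, Pi.add_apply]; ring

lemma integral_rieszKer_pos {s a : ℝ} (hs : -1 < s) (hs1 : s < 1) (ha : 0 < a) (ha1 : a ≤ 1) :
    0 < ∫ u in Ioc 0 a, rieszKer s u := by
  rw [← intervalIntegral.integral_of_le ha.le]
  exact intervalIntegral.intervalIntegral_pos_of_pos_on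
    ((intervalIntegrable_iff_integrableOn_Ioc_of_le ha.le).2
      (rieszKer_integrableOn_Ioc hs hs1 a))
    (fun u hu => rieszKer_pos hu.1 (hu.2.trans_le ha1).ne) ha

lemma IsProfile.le_rieszPot {s x a : ℝ} (hs : -1 < s) (hs1 : s < 1) {g : ℝ → ℝ}
    (hg : IsProfile s g) (hx : 0 < x) (ha : 0 < a) :
    x ^ (s + 1) * (g (x * a) * ∫ u in Ioc 0 a, rieszKer s u) ≤ rieszPot s g x := by
  have hRi := hg.integrableOn_rieszKer hs hs1 hx
  refine mul_le_mul_of_nonneg_left ?_ (Real.rpow_nonneg hx.le _)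
  rw [← integral_const_mul]
  refine le_trans (setIntegral_mono_on ((rieszKer_integrableOn_Ioc hs hs1 a).const_mul _)
    (hRi.mono_set Ioc_subset_Ioi_self) measurableSet_Ioc fun u hu => ?_)
    (setIntegral_mono_set hRi ?_ Ioc_subset_Ioi_self.eventuallyLE)
  · exact mul_le_mul_of_nonneg_right (hg.antitoneOn (mul_pos hx hu.1).le (mul_pos hx ha).le
      (mul_le_mul_of_nonneg_left hu.2 hx.le)) (rieszKer_nonneg hu.1.le)
  · refine (ae_restrict_iff' measurableSet_Ioi).2 (Eventually.of_forall fun u hu => ?_)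
    exact mul_nonneg (hg.nonneg _ (mul_pos hx hu).le) (rieszKer_nonneg (le_of_lt hu))

lemma IsProfile.rieszPot_pos {s x y : ℝ} (hs : -1 < s) (hs1 : s < 1) {g : ℝ → ℝ}
    (hg : IsProfile s g) (hx : 0 < x) (hy : 0 < y) (hgy : 0 < g y) : 0 < rieszPot s g x := by
  have ha : 0 < min 1 (y / x) := lt_min one_pos (div_pos hy hx)
  refine lt_of_lt_of_le ?_ (hg.le_rieszPot hs hs1 hx ha)
  have hle : x * min 1 (y / x) ≤ y := by
    have := mul_le_mul_of_nonneg_left (min_le_right 1 (y / x)) hx.le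
    rwa [mul_div_cancel₀ _ hx.ne'] at this
  have : g y ≤ g (x * min 1 (y / x)) := hg.antitoneOn (mul_pos hx ha).le hy.le hle
  exact mul_pos (Real.rpow_pos_of_pos hx _)
    (mul_pos (hgy.trans_le this) (integral_rieszKer_pos hs hs1 ha (min_le_left _ _)))

/-- The fixed-point equation without truncation has no nonnegative decreasing solution. -/
lemma false_of_forall_eq_potential {s B : ℝ} (hs : -1 < s) (hs1 : s < 1) (hB : 0 < B)
    {f : ℝ → ℝ} (hfc : Continuous f) (hfa : AntitoneOn f (Ici 0))
    (hf0 : ∀ y ∈ Ici (0 : ℝ), 0 ≤ f y) (hfq : ∀ y, 1 - y ^ 2 ≤ f y)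
    {x₀ : ℝ} (hx₀ : 0 ≤ x₀) (hfx₀ : f x₀ < 1)
    (heq : ∀ x, 0 < x → B * (f x - 1) =
      x ^ (s + 1) * ∫ u in Ioi (0 : ℝ), f (x * u) * diffKer s u) : False := by
  obtain ⟨L, hL⟩ : ∃ L, Tendsto f atTop (nhds L) := by
    have hanti : Antitone fun x : ℝ => f (max x 0) := fun x y hxy =>
      hfa (mem_Ici.2 (le_max_right x 0)) (mem_Ici.2 (le_max_right y 0)) (max_le_max_right 0 hxy)
    have hbdd : BddBelow (range fun x : ℝ => f (max x 0)) :=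
      ⟨0, by rintro _ ⟨x, rfl⟩; exact hf0 _ (mem_Ici.2 (le_max_right x 0))⟩
    refine ⟨_, (tendsto_atTop_ciInf hanti hbdd).congr' ?_⟩
    filter_upwards [eventually_ge_atTop 0] with x hx
    rw [max_eq_left hx]
  have hLf : ∀ y ∈ Ici (0 : ℝ), L ≤ f y := by
    intro y hy
    refine le_of_tendsto hL ?_
    filter_upwards [eventually_ge_atTop y] with z hz
    exact hfa hy (le_trans hy hz) hz
  have hL0 : 0 ≤ L := by
    refine ge_of_tendsto hL ?_
    filter_upwards [eventually_ge_atTop 0] with z hz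
    exact hf0 z hz
  have hL1 : L < 1 := (hLf x₀ hx₀).trans_lt hfx₀
  have hg : IsProfile s fun y => f y - L :=
    { continuous := by fun_prop
      antitoneOn := fun x hx y hy hxy => sub_le_sub_right (hfa hx hy hxy) L
      nonneg := fun y hy => sub_nonneg.2 (hLf y hy)
      integrableOn := integrableOn_sub_limit_mul_rpow hs hs1 hfc hfa hf0 hL hLf (B := B)
        fun x hx => by
          rw [← heq x hx]
          nlinarith [hf0 x hx.le] }
  set g : ℝ → ℝ := fun y => f y - L with hgdef
  obtain ⟨hki, hk0⟩ := diffKer_integral hs hs1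
  have hpot : ∀ x, 0 < x → rieszPot s g x =
      B * g x + (B * (L - 1) + 2 * ∫ y in Ioi (0 : ℝ), g y * y ^ s) := by
    intro x hx
    have h := hg.integral_diffKer hs hs1 hx
    have h2 : ∫ u in Ioi (0 : ℝ), g (x * u) * diffKer s u =
        ∫ u in Ioi (0 : ℝ), f (x * u) * diffKer s u := by
      simp only [hgdef, sub_mul]
      rw [integral_sub (integrableOn_comp_mul_diffKer hs hs1 hfc hfa hf0 hx) (hki.const_mul L),
        integral_const_mul, hk0]
      ring
    rw [h2, ← heq x hx] at h
    simp only [hgdef] at h ⊢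
    linarith
  have hβ := hg.nonpos_of_le_rieszPot hs hs1
    (β := B * (L - 1) + 2 * ∫ y in Ioi (0 : ℝ), g y * y ^ s) fun x hx => by
      rw [hpot x hx]
      linarith [mul_nonneg hB.le (hg.nonneg x hx.le)]
  set κ : ℝ := ∫ u in Ioc (0 : ℝ) 1, rieszKer s u
  have hκ : 0 < κ := integral_rieszKer_pos hs hs1 one_pos le_rfl
  obtain ⟨x, hx, hxB⟩ : ∃ x : ℝ, 0 < x ∧ B < x ^ (s + 1) * κ :=
    ((eventually_gt_atTop 0).and (((tendsto_rpow_atTop (by linarith : 0 < s + 1)).atTop_mul_const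
      hκ).eventually_gt_atTop B)).exists
  have hlow := hg.le_rieszPot hs hs1 hx one_pos
  rw [mul_one] at hlow
  have hpos : 0 < rieszPot s g x := by
    refine hg.rieszPot_pos hs hs1 hx (y := (1 - L) / 2) (by linarith) ?_
    simp only [hgdef]
    nlinarith [hfq ((1 - L) / 2)]
  have hgx := hg.nonneg x hx.le
  have := hpot x hx
  nlinarith

lemma C1_pos {α : ℝ} (hα : α ∈ Ioo (0 : ℝ) 1) : 0 < C1 α := by
  have h1 := Real.Gamma_pos_of_pos (by linarith [hα.1] : (0 : ℝ) < 1 / 2 + α)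
  have h2 := Real.Gamma_pos_of_pos (by linarith [hα.2] : (0 : ℝ) < 1 - α)
  have := Real.pi_pos
  unfold C1
  positivity

lemma etaC_pos {α : ℝ} (hα : α ∈ Ioo (0 : ℝ) 1) : 0 < etaC α := by
  have h1 : 0 < 3 - 2 * α := by linarith [hα.2]
  have h2 : 0 < 5 - 2 * α := by linarith [hα.2]
  unfold etaC
  positivity

lemma TV_eq {α x : ℝ} (f : ℝ → ℝ) (hx : 0 < x) :
    TV α f x = C1 α * (x ^ (1 - 2 * α + 1) *
      ∫ u in Ioi (0 : ℝ), f (x * u) * diffKer (1 - 2 * α) u) := by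
  have hne : ∀ᵐ u : ℝ, u ≠ 1 := by simp [ae_iff]
  have hcov : ∀ g : ℝ → ℝ, ∫ ξ in Ioi (0 : ℝ), g ξ = x * ∫ u in Ioi (0 : ℝ), g (x * u) := by
    intro g
    rw [integral_comp_mul_left_Ioi g 0 hx, mul_zero, smul_eq_mul, mul_inv_cancel_left₀ hx.ne']
  have hadd : ∀ u : ℝ, x + x * u = x * (1 + u) := fun u => by ring
  have habs : ∀ u : ℝ, |x - x * u| = x * |1 - u| := fun u => by
    rw [show x - x * u = x * (1 - u) by ring, abs_mul, abs_of_pos hx]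
  rw [TV, if_neg hx.ne', abs_of_pos hx]
  split_ifs with h
  · have hs : 1 - 2 * α = 0 := by rw [h]; norm_num
    rw [hs, zero_add, Real.rpow_one, hcov]
    congr 2
    refine setIntegral_congr_ae measurableSet_Ioi ?_
    filter_upwards [hne] with u hu1 hu
    rw [diffKer, rieszKer_zero hu hu1, Real.rpow_zero, hadd, habs,
      mul_div_mul_left _ _ hx.ne', mul_div_cancel_left₀ _ hx.ne', mul_one]
  · have hs : 1 - 2 * α ≠ 0 := fun h0 => h (by linarith)
    set s := 1 - 2 * α
    have hint : ∫ u in Ioi (0 : ℝ), f (x * u) * (x * u / x *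
        ((x + x * u) ^ s - |x - x * u| ^ s) - 2 * s * (x * u) ^ s) =
        s * x ^ s * ∫ u in Ioi (0 : ℝ), f (x * u) * diffKer s u := by
      rw [← integral_const_mul]
      refine setIntegral_congr_ae measurableSet_Ioi ?_
      filter_upwards [hne] with u hu1 hu
      have hu0 : 0 < u := hu
      rw [diffKer, rieszKer_of_ne hs hu hu1, hadd, habs, Real.mul_rpow hx.le (by linarith),
        Real.mul_rpow hx.le (abs_nonneg _), Real.mul_rpow hx.le hu0.le,
        mul_div_cancel_left₀ _ hx.ne']
      field_simp
    rw [hcov, hint, Real.rpow_add_one hx.ne']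
    field_simp

lemma integrableOn_one_sub_mul_rpow {α : ℝ} (hα : α ∈ Ioo (0 : ℝ) 1) {f : ℝ → ℝ}
    (hfc : Continuous f) (hf0 : ∀ y ∈ Ici (0 : ℝ), 0 ≤ f y) (hf1 : ∀ y ∈ Ici (0 : ℝ), f y ≤ 1)
    (hfq : ∀ y, 1 - y ^ 2 ≤ f y) :
    IntegrableOn (fun ξ => (1 - f ξ) * ξ ^ (-1 - 2 * α)) (Ioi 0) := by
  have hmeas : Measurable fun ξ => (1 - f ξ) * ξ ^ (-1 - 2 * α) :=
    (hfc.measurable.const_sub 1).mul (measurable_id.pow_const _)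
  have hnorm : ∀ ξ : ℝ, 0 < ξ → ‖(1 - f ξ) * ξ ^ (-1 - 2 * α)‖ =
      (1 - f ξ) * ξ ^ (-1 - 2 * α) := fun ξ hξ =>
    Real.norm_of_nonneg (mul_nonneg (sub_nonneg.2 (hf1 ξ hξ.le)) (Real.rpow_nonneg hξ.le _))
  rw [← Ioc_union_Ioi_eq_Ioi (zero_le_one : (0 : ℝ) ≤ 1)]
  refine IntegrableOn.union ?_ ?_
  · have hi : IntegrableOn (fun ξ : ℝ => ξ ^ (1 - 2 * α)) (Ioc 0 1) :=
      (intervalIntegrable_iff_integrableOn_Ioc_of_le zero_le_one).1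
        (intervalIntegral.intervalIntegrable_rpow' (by linarith [hα.2]))
    refine Integrable.mono' hi hmeas.aestronglyMeasurable
      ((ae_restrict_iff' measurableSet_Ioc).2 (Eventually.of_forall fun ξ hξ => ?_))
    rw [hnorm ξ hξ.1, show 1 - 2 * α = 2 + (-1 - 2 * α) by ring, Real.rpow_add hξ.1,
      Real.rpow_two]
    exact mul_le_mul_of_nonneg_right (by linarith [hfq ξ]) (Real.rpow_nonneg hξ.1.le _)
  · refine Integrable.mono' (integrableOn_Ioi_rpow_of_lt (by linarith [hα.1] : -1 - 2 * α < -1)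
      zero_lt_one) hmeas.aestronglyMeasurable
      ((ae_restrict_iff' measurableSet_Ioi).2 (Eventually.of_forall fun ξ hξ => ?_))
    have hξ0 : 0 < ξ := zero_lt_one.trans hξ
    rw [hnorm ξ hξ0]
    exact mul_le_of_le_one_left (Real.rpow_nonneg hξ0.le _) (by linarith [hf0 ξ hξ0.le])

lemma cV_pos {α : ℝ} (hα : α ∈ Ioo (0 : ℝ) 1) {f : ℝ → ℝ}
    (hfc : Continuous f) (hfa : AntitoneOn f (Ici 0)) (hf0 : ∀ y ∈ Ici (0 : ℝ), 0 ≤ f y)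
    (hf1 : ∀ y ∈ Ici (0 : ℝ), f y ≤ 1) (hfq : ∀ y, 1 - y ^ 2 ≤ f y)
    {x₀ : ℝ} (hx₀ : 0 < x₀) (hfx₀ : f x₀ < 1) : 0 < cV α f := by
  have hα0 := hα.1
  have hi := integrableOn_one_sub_mul_rpow hα hfc hf0 hf1 hfq
  have hsub : Ioi x₀ ⊆ Ioi 0 := Ioi_subset_Ioi hx₀.le
  have hexp : -1 - 2 * α < -1 := by linarith
  have hpow : 0 < ∫ ξ in Ioi x₀, ξ ^ (-1 - 2 * α) := by
    rw [integral_Ioi_rpow_of_lt hexp hx₀, neg_div, ← div_neg]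
    exact div_pos (Real.rpow_pos_of_pos hx₀ _) (by linarith)
  have hlow : (1 - f x₀) * ∫ ξ in Ioi x₀, ξ ^ (-1 - 2 * α) ≤
      ∫ ξ in Ioi (0 : ℝ), (1 - f ξ) * ξ ^ (-1 - 2 * α) := by
    rw [← integral_const_mul]
    refine le_trans (setIntegral_mono_on ((integrableOn_Ioi_rpow_of_lt hexp hx₀).const_mul _)
      (hi.mono_set hsub) measurableSet_Ioi fun ξ hξ => ?_)
      (setIntegral_mono_set hi ?_ hsub.eventuallyLE)
    · exact mul_le_mul_of_nonneg_right
        (sub_le_sub_left (hfa hx₀.le (hx₀.le.trans (le_of_lt hξ)) (le_of_lt hξ)) 1)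
        (Real.rpow_nonneg (hx₀.le.trans (le_of_lt hξ)) _)
    · exact (ae_restrict_iff' measurableSet_Ioi).2 (Eventually.of_forall fun ξ hξ =>
        mul_nonneg (sub_nonneg.2 (hf1 ξ (mem_Ioi.1 hξ).le)) (Real.rpow_nonneg (le_of_lt hξ) _))
  have hC := C1_pos hα
  unfold cV
  exact mul_pos (by positivity) ((mul_pos (sub_pos.2 hfx₀) hpow).trans_le hlow)

lemma exists_lt_one_of_hasDerivWithinAt {f : ℝ → ℝ} {d : ℝ}
    (hf1 : ∀ y ∈ Ici (0 : ℝ), f y ≤ 1) (hd : HasDerivWithinAt f d (Iio (1 / 2)) (1 / 2))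
    (hd0 : d < 0) : ∃ x₀, 0 < x₀ ∧ f x₀ < 1 := by
  by_contra! h
  have hone : ∀ y : ℝ, 0 < y → f y = 1 := fun y hy => le_antisymm (hf1 y hy.le) (h y hy)
  have hev : f =ᶠ[nhdsWithin (1 / 2) (Iio (1 / 2))] fun _ => 1 := by
    filter_upwards [nhdsWithin_le_nhds (Ioi_mem_nhds (by norm_num : (0 : ℝ) < 1 / 2))] with y hy
    exact hone y hy
  have hconst := (hasDerivWithinAt_const (1 / 2 : ℝ) (Iio (1 / 2)) (1 : ℝ)).congr_of_eventuallyEq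
    hev (hone _ (by norm_num))
  exact hd0.ne ((uniqueDiffWithinAt_Iio (1 / 2 : ℝ)).eq_deriv _ hd hconst)

/-- A nonnegative function that is non-increasing on `[0,∞)` and vanishes at `X` is a profile. -/
lemma isProfile_of_eq_zero {s X : ℝ} (hs : -1 < s) {f : ℝ → ℝ} (hfc : Continuous f)
    (hfa : AntitoneOn f (Ici 0)) (hf0 : ∀ y ∈ Ici (0 : ℝ), 0 ≤ f y)
    (hfX : ∀ y, X ≤ y → f y = 0) : IsProfile s f where
  continuous := hfc
  antitoneOn := hfa
  nonneg := hf0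
  integrableOn := by
    refine (integrableOn_mul_rpow_Ioc hs hfc X).of_forall_sdiff_eq_zero measurableSet_Ioi
      fun y hy => ?_
    have hy0 : X ≤ y := le_of_not_ge fun h => hy.2 ⟨hy.1, h⟩
    rw [hfX y hy0, zero_mul]

/-- Any fixed point `f ∈ 𝒱₁` of `ℛ_α` has compact support; consequently
`f(x) → 0` as `x → +∞`, the quantity `b(f) = 2c_{1,α} ∫₀^∞ f(ξ) ξ^{1-2α} dξ`
is finite, `c(f) < b(f)`, and the scaling parameter `c_ℓ = c(f) - b(f)` is
strictly negative (expanding-type blow-up). -/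
theorem fixed_point_compact_support (α : ℝ) (hα : α ∈ Ioo (0:ℝ) 1)
    (f : ℝ → ℝ) (hf : V1 α f) (hfix : ∀ x : ℝ, RV α f x = f x) :
    HasCompactSupport f ∧ Tendsto f atTop (nhds 0) ∧
    IntegrableOn (fun ξ => f ξ * ξ ^ (1 - 2*α)) (Ioi (0:ℝ)) ∧
    cV α f < bV α f ∧ cV α f - bV α f < 0 := by
  obtain ⟨hfc, heven, -, hfz, hf0, hfa, -, hfm, d, hd, hdη⟩ := hf
  have hs : -1 < 1 - 2 * α := by linarith [hα.2]
  have hs1 : 1 - 2 * α < 1 := by linarith [hα.1]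
  have hfq : ∀ y, 1 - y ^ 2 ≤ f y := fun y => (le_max_right _ _).trans (hfm y)
  have hf1 : ∀ y ∈ Ici (0 : ℝ), f y ≤ 1 := fun y hy => (hfa self_mem_Ici hy hy).trans_eq hfz
  obtain ⟨x₀, hx₀, hfx₀⟩ := exists_lt_one_of_hasDerivWithinAt hf1 hd
    (hdη.trans_lt (neg_lt_zero.2 (etaC_pos hα)))
  have hC := C1_pos hα
  have hc := cV_pos hα hfc hfa hf0 hf1 hfq hx₀ hfx₀
  obtain ⟨X, hX0, hfX⟩ : ∃ X, 0 < X ∧ f X = 0 := by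
    by_contra! h
    refine false_of_forall_eq_potential hs hs1 (div_pos hc hC) hfc hfa hf0 hfq hx₀.le hfx₀
      fun x hx => ?_
    have hpos : 0 < f x := lt_of_le_of_ne (hf0 x hx.le) (h x hx).symm
    have hRx := hfix x
    rw [RV] at hRx
    rcases max_choice 0 (1 + TV α f x / cV α f) with hmax | hmax
    · exact absurd (hRx.symm.trans hmax) hpos.ne'
    · rw [hmax, TV_eq f hx] at hRx
      rw [← hRx]
      field_simp
      ring
  have hzero : ∀ y, X ≤ y → f y = 0 := fun y hy =>
    le_antisymm ((hfa hX0.le (hX0.le.trans hy) hy).trans_eq hfX) (hf0 y (hX0.le.trans hy))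
  have hprof : IsProfile (1 - 2 * α) f := isProfile_of_eq_zero hs hfc hfa hf0 hzero
  have hsupp : HasCompactSupport f := by
    refine HasCompactSupport.intro (isCompact_Icc (a := -X) (b := X)) fun y hy => ?_
    rcases lt_or_ge y (-X) with h | h
    · rw [← heven]
      exact hzero _ (by linarith)
    · exact hzero _ (le_of_not_ge fun h' => hy ⟨h, h'⟩)
  have hlt : cV α f < bV α f := by
    have hR := hfix X
    rw [RV, hfX, max_eq_left_iff, TV_eq f hX0, hprof.integral_diffKer hs hs1 hX0] at hR
    have hle := (div_le_iff₀ hc).1 (le_neg_iff_add_nonpos_left.2 hR)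
    have hpot := hprof.rieszPot_pos hs hs1 hX0 (y := 1 / 2) (by norm_num)
      (lt_of_lt_of_le (by norm_num) (hfq (1 / 2)))
    have hCpot := mul_pos hC hpot
    unfold bV
    linarith
  refine ⟨hsupp, ?_, hprof.integrableOn, hlt, sub_neg.2 hlt⟩
  refine tendsto_const_nhds.congr' ?_
  filter_upwards [eventually_ge_atTop X] with y hy
  exact (hzero y hy).symm

end GSQGplane
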